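/- Let β ≥ 0 and ρ ≥ 0, let α, η : [0,∞) → ℝ be continuous with α(t) ≥ 0 and η(t) ≥ 0 for all t ≥ 0, and let S, I, R : [0,∞) → ℝ be continuously differentiable functions satisfying, for all t ≥ 0, the system S'(t) = −β S(t) I(t) − α(t) S(t) − η(t) S(t), I'(t) = β S(t) I(t) − ρ I(t) + η(t) S(t), R'(t) = ρ I(t) + α(t) S(t). If S(0) ≥ 0, I(0) ≥ 0, R(0) ≥ 0 and S(0) + I(0) + R(0) = 1, then for all t ≥ 0 one has 0 ≤ S(t) ≤ 1, 0 ≤ I(t) ≤ 1 and 0 ≤ R(t) ≤ 1. -/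

import Mathlib

theorem sir_aux (c f f' : ℝ → ℝ) (hc : ContinuousOn c (Set.Ici 0))
    (hf : ∀ t ≥ (0:ℝ), HasDerivAt f (f' t) t)
    (hle : ∀ t ≥ (0:ℝ), c t * f t ≤ f' t) (h0 : 0 ≤ f 0) :
    ∀ t ≥ (0:ℝ), 0 ≤ f t := by
  have hd : Continuous (fun t => c (max t 0)) :=
    hc.comp_continuous (by fun_prop) (fun t => le_max_right t 0)
  have hF : ∀ t, HasDerivAt (fun t => ∫ s in (0:ℝ)..t, c (max s 0)) (c (max t 0)) t :=
    fun t => hd.integral_hasStrictDerivAt 0 t |>.hasDerivAt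
  set F : ℝ → ℝ := fun t => ∫ s in (0:ℝ)..t, c (max s 0) with hFdef
  have hG : ∀ t ≥ (0:ℝ), HasDerivAt (fun t => f t * Real.exp (-F t))
      (f' t * Real.exp (-F t) + f t * (Real.exp (-F t) * (-c (max t 0)))) t :=
    fun t ht => (hf t ht).mul ((hF t).neg.exp)
  have hm : MonotoneOn (fun t => f t * Real.exp (-F t)) (Set.Ici 0) := by
    apply monotoneOn_of_deriv_nonneg (convex_Ici 0)
    · exact fun t ht => (hG t ht).continuousAt.continuousWithinAt
    · intro t ht
      exact (hG t (interior_subset ht)).differentiableAt.differentiableWithinAt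
    · intro t ht
      have ht' : (0:ℝ) ≤ t := interior_subset ht
      rw [(hG t ht').deriv, max_eq_left ht']
      have := mul_nonneg (sub_nonneg.2 (hle t ht')) (Real.exp_pos (-F t)).le
      linarith
  intro t ht
  have h1 := hm (Set.mem_Ici.2 le_rfl) (Set.mem_Ici.2 ht) ht
  have h2 : 0 ≤ f t * Real.exp (-F t) :=
    le_trans (mul_nonneg h0 (Real.exp_pos _).le) h1
  exact nonneg_of_mul_nonneg_left h2 (Real.exp_pos _)

/-- Invariance of the unit simplex for the controlled SIR dynamics. -/
theorem sir_simplex_invariant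
    (β ρ : ℝ) (hβ : 0 ≤ β) (hρ : 0 ≤ ρ)
    (α η : ℝ → ℝ) (hα : Continuous α) (hη : Continuous η)
    (hα0 : ∀ t ≥ (0:ℝ), 0 ≤ α t) (hη0 : ∀ t ≥ (0:ℝ), 0 ≤ η t)
    (S I R : ℝ → ℝ)
    (hS : ∀ t ≥ (0:ℝ), HasDerivAt S (-β * S t * I t - α t * S t - η t * S t) t)
    (hI : ∀ t ≥ (0:ℝ), HasDerivAt I (β * S t * I t - ρ * I t + η t * S t) t)
    (hR : ∀ t ≥ (0:ℝ), HasDerivAt R (ρ * I t + α t * S t) t)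
    (hS0 : 0 ≤ S 0) (hI0 : 0 ≤ I 0) (hR0 : 0 ≤ R 0)
    (hsum : S 0 + I 0 + R 0 = 1) :
    ∀ t ≥ (0:ℝ),
      (0 ≤ S t ∧ S t ≤ 1) ∧ (0 ≤ I t ∧ I t ≤ 1) ∧ (0 ≤ R t ∧ R t ≤ 1) := by
  have cS : ContinuousOn S (Set.Ici 0) := fun t ht => (hS t ht).continuousAt.continuousWithinAt
  have cI : ContinuousOn I (Set.Ici 0) := fun t ht => (hI t ht).continuousAt.continuousWithinAt
  have pS : ∀ t ≥ (0:ℝ), 0 ≤ S t :=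
    sir_aux (fun t => -β * I t - α t - η t) S _
      (((cI.const_mul _).sub hα.continuousOn).sub hη.continuousOn) hS
      (fun t ht => le_of_eq (by ring)) hS0
  have pI : ∀ t ≥ (0:ℝ), 0 ≤ I t :=
    sir_aux (fun t => β * S t - ρ) I _ ((cS.const_mul _).sub continuousOn_const) hI
      (fun t ht => by
        have := mul_nonneg (hη0 t ht) (pS t ht)
        linarith) hI0
  have pR : ∀ t ≥ (0:ℝ), 0 ≤ R t :=
    sir_aux (fun _ => 0) R _ continuousOn_const hR
      (fun t ht => by
        have := mul_nonneg (hα0 t ht) (pS t ht)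
        have := mul_nonneg hρ (pI t ht)
        linarith) hR0
  have pT : ∀ t ≥ (0:ℝ), 0 ≤ 1 - (S t + I t + R t) :=
    sir_aux (fun _ => 0) (fun t => 1 - (S t + I t + R t)) _ continuousOn_const
      (fun t ht => (((hS t ht).add (hI t ht)).add (hR t ht)).const_sub 1)
      (fun t ht => le_of_eq (by ring)) (by simp [hsum])
  intro t ht
  have a := pS t ht
  have b := pI t ht
  have c := pR t ht
  have d := pT t ht
  refine ⟨⟨a, ?_⟩, ⟨b, ?_⟩, ⟨c, ?_⟩⟩ <;> linarith
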